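/- arXiv:2209.10990 — 2 statements merged into one kernel-verified Lean document; each statement's English description precedes it below -/
import Mathlib

section
/- The limit as ε → 0⁺ of ( ∫_ε^∞ (1/t)·(1/t − 1/(e^t − 1)) dt + (log ε)/2 ) equals C = (log(2π) − γ)/2, where γ is the Euler–Mascheroni constant. -/
open MeasureTheory Filter

open Set Topology

lemma integral_Ioi_log_mul_exp_neg :
    ∫ t in Ioi (0 : ℝ), Real.log t * Real.exp (-t) = -Real.eulerMascheroniConstant := by
  have h1 := Complex.hasDerivAt_GammaIntegral (s := 1) (by simp)
  have h2 : HasDerivAt Complex.GammaIntegral (-(Real.eulerMascheroniConstant : ℂ)) 1 := by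
    refine Complex.hasDerivAt_Gamma_one.congr_of_eventuallyEq ?_
    filter_upwards [(isOpen_lt continuous_const Complex.continuous_re).mem_nhds
      (show (0 : ℝ) < (1 : ℂ).re by simp)] with s hs
    exact (Complex.Gamma_eq_integral hs).symm
  have h3 := h1.unique h2
  simp only [sub_self, Complex.cpow_zero, one_mul] at h3
  have h4 : ((∫ t in Ioi (0 : ℝ), Real.log t * Real.exp (-t) : ℝ) : ℂ) =
      ((-Real.eulerMascheroniConstant : ℝ) : ℂ) := by
    rw [← integral_complex_ofReal]
    push_cast
    rw [← h3]
    push_cast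
    rfl
  exact_mod_cast h4

lemma integrableOn_log_mul_exp_neg :
    IntegrableOn (fun t : ℝ => Real.log t * Real.exp (-t)) (Ioi 0) := by
  refine Integrable.of_integral_ne_zero ?_
  rw [integral_Ioi_log_mul_exp_neg]
  linarith [Real.one_half_lt_eulerMascheroniConstant]

lemma integrableOn_inv_mul_exp_neg {ε : ℝ} (hε : 0 < ε) :
    IntegrableOn (fun t : ℝ => t⁻¹ * Real.exp (-t)) (Ioi ε) := by
  have h : IntegrableOn (fun t : ℝ => Real.exp (-t)) (Ioi ε) := by
    simpa using exp_neg_integrableOn_Ioi ε one_pos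
  refine (h.const_mul ε⁻¹).mono' (by fun_prop) ?_
  filter_upwards [ae_restrict_mem measurableSet_Ioi] with t ht
  have ht' : ε < t := ht
  have : 0 < t := hε.trans ht'
  rw [Real.norm_of_nonneg (by positivity)]
  gcongr

lemma tendsto_log_mul_exp_neg_atTop :
    Tendsto (fun t : ℝ => Real.log t * Real.exp (-t)) atTop (𝓝 0) := by
  have h := Real.tendsto_pow_mul_exp_neg_atTop_nhds_zero 1
  refine tendsto_of_tendsto_of_tendsto_of_le_of_le' tendsto_const_nhds h ?_ ?_
  · filter_upwards [eventually_ge_atTop 1] with t ht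
    exact mul_nonneg (Real.log_nonneg ht) (Real.exp_pos _).le
  · filter_upwards [eventually_ge_atTop 1] with t ht
    have := Real.log_le_sub_one_of_pos (show 0 < t by linarith)
    gcongr
    linarith

lemma integral_Ioi_inv_mul_exp_neg {ε : ℝ} (hε : 0 < ε) :
    ∫ t in Ioi ε, t⁻¹ * Real.exp (-t) =
      (∫ t in Ioi ε, Real.log t * Real.exp (-t)) - Real.log ε * Real.exp (-ε) := by
  have hi := integrableOn_inv_mul_exp_neg hε
  have hj := integrableOn_log_mul_exp_neg.mono_set (Ioi_subset_Ioi hε.le)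
  have h := integral_Ioi_of_hasDerivAt_of_tendsto'
    (f := fun t : ℝ => Real.log t * Real.exp (-t))
    (f' := fun t : ℝ => t⁻¹ * Real.exp (-t) - Real.log t * Real.exp (-t)) (a := ε)
    (fun t ht => by
      have ht' : t ≠ 0 := (hε.trans_le ht).ne'
      exact ((Real.hasDerivAt_log ht').mul (hasDerivAt_neg t).exp).congr_deriv (by ring))
    (hi.sub hj) tendsto_log_mul_exp_neg_atTop
  rw [integral_sub hi hj] at h
  linarith

/-- `∫_ε^∞ e^{-t} / t dt + log ε → -γ` as `ε → 0⁺`. -/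
lemma tendsto_integral_inv_mul_exp_neg_add_log :
    Tendsto (fun ε : ℝ => (∫ t in Ioi ε, t⁻¹ * Real.exp (-t)) + Real.log ε) (𝓝[>] 0)
      (𝓝 (-Real.eulerMascheroniConstant)) := by
  have h1 : Tendsto (fun ε : ℝ => ∫ t in Ioi ε, Real.log t * Real.exp (-t)) (𝓝[>] 0)
      (𝓝 (-Real.eulerMascheroniConstant)) := by
    rw [← integral_Ioi_log_mul_exp_neg]
    exact integrableOn_log_mul_exp_neg.continuousWithinAt_Ici_primitive_Ioi.mono_left
      (nhdsWithin_mono 0 Ioi_subset_Ici_self)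
  have h2 : Tendsto (fun ε : ℝ => Real.log ε * (1 - Real.exp (-ε))) (𝓝[>] 0) (𝓝 0) := by
    have h3 : Tendsto (fun ε : ℝ => Real.log ε * ε) (𝓝[>] 0) (𝓝 0) := by
      simpa using tendsto_log_mul_rpow_nhdsGT_zero one_pos
    refine squeeze_zero_norm' ?_ (by simpa using h3.norm)
    filter_upwards [self_mem_nhdsWithin] with ε hε
    have hε' : 0 < ε := hε
    have h4 : Real.exp (-ε) ≤ 1 := Real.exp_le_one_iff.2 (by linarith)
    have h5 := Real.add_one_le_exp (-ε)
    rw [norm_mul, Real.norm_of_nonneg (sub_nonneg.2 h4), Real.norm_eq_abs]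
    gcongr
    exact (abs_of_pos hε').symm ▸ by linarith
  have h3 := h1.add h2
  rw [add_zero] at h3
  refine h3.congr' ?_
  filter_upwards [self_mem_nhdsWithin] with ε hε
  rw [integral_Ioi_inv_mul_exp_neg hε]
  ring

lemma integrableOn_inv_mul_exp_sub_exp {a : ℝ} (ha : 0 < a) :
    IntegrableOn (fun t : ℝ => t⁻¹ * (Real.exp (-(a * t)) - Real.exp (-((a + 1) * t))))
      (Ioi 0) := by
  have h : IntegrableOn (fun t : ℝ => Real.exp (-(a * t))) (Ioi 0) := by
    simpa using exp_neg_integrableOn_Ioi 0 ha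
  refine h.mono' (by fun_prop) ?_
  filter_upwards [ae_restrict_mem measurableSet_Ioi] with t ht
  have ht' : 0 < t := ht
  have h1 : Real.exp (-t) ≤ 1 := Real.exp_le_one_iff.2 (by linarith)
  have h2 := Real.add_one_le_exp (-t)
  have h3 : Real.exp (-((a + 1) * t)) = Real.exp (-(a * t)) * Real.exp (-t) := by
    rw [← Real.exp_add]; ring_nf
  have h4 := Real.exp_pos (-(a * t))
  have h5 : t⁻¹ * (Real.exp (-(a * t)) - Real.exp (-((a + 1) * t))) =
      Real.exp (-(a * t)) * (t⁻¹ * (1 - Real.exp (-t))) := by rw [h3]; ring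
  have h6 : 0 ≤ t⁻¹ * (1 - Real.exp (-t)) := mul_nonneg (by positivity) (by linarith)
  rw [h5, Real.norm_of_nonneg (mul_nonneg h4.le h6)]
  refine mul_le_of_le_one_right h4.le ?_
  rw [inv_mul_le_iff₀ ht']
  linarith

lemma integral_inv_mul_exp_sub_exp {a : ℝ} (ha : 0 < a) :
    ∫ t in Ioi (0 : ℝ), t⁻¹ * (Real.exp (-(a * t)) - Real.exp (-((a + 1) * t))) =
      Real.log (a + 1) - Real.log a := by
  have h := Frullani.integral_Ioi_eq (f := fun t : ℝ => Real.exp (-t)) (a := a) (b := a + 1)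
    (L := 1) (R := 0)
    ((by fun_prop : Continuous fun t : ℝ => Real.exp (-t)).locallyIntegrable.locallyIntegrableOn _)
    ha (by linarith)
    (tendsto_nhdsWithin_of_tendsto_nhds <| by
      simpa using (by fun_prop : Continuous fun t : ℝ => Real.exp (-t)).tendsto 0)
    (Real.tendsto_exp_atBot.comp tendsto_neg_atTop_atBot)
    (by simpa using integrableOn_inv_mul_exp_sub_exp ha)
  rw [Real.log_div (by linarith) ha.ne'] at h
  simpa using h

/-- The function `(1/t) (1/t - 1/(e^t-1) - e^{-t}/2)`, which is integrable on `(0, ∞)`. -/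
noncomputable def expKernel (t : ℝ) : ℝ :=
  t⁻¹ * (t⁻¹ - (Real.exp t - 1)⁻¹ - Real.exp (-t) / 2)

lemma measurable_expKernel : Measurable expKernel := by
  unfold expKernel
  fun_prop

lemma abs_expKernel_le_of_le_one {t : ℝ} (h0 : 0 < t) (h1 : t ≤ 1) : |expKernel t| ≤ 2 := by
  have hb := Real.exp_bound (x := t) (by rwa [abs_of_pos h0]) (n := 3) (by norm_num)
  rw [abs_of_pos h0] at hb
  norm_num [Finset.sum_range_succ, Nat.factorial] at hb
  obtain ⟨hl, hu⟩ := abs_le.1 hb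
  have he : t ≤ Real.exp t - 1 := by linarith [Real.add_one_le_exp t]
  have hpos : 0 < Real.exp t - 1 := by linarith
  have hn1 := Real.add_one_le_exp (-t)
  have hn2 : Real.exp (-t) ≤ 1 := Real.exp_le_one_iff.2 (by linarith)
  set E := Real.exp t with hE
  have hkey : |t⁻¹ - (E - 1)⁻¹ - 1 / 2| ≤ t := by
    have : t⁻¹ - (E - 1)⁻¹ - 1 / 2 = (2 * (E - 1 - t) - t * (E - 1)) / (2 * t * (E - 1)) := by
      field_simp
    rw [this, abs_div, abs_of_pos (show 0 < 2 * t * (E - 1) by positivity),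
      div_le_iff₀ (by positivity)]
    have h3 : 0 < t ^ 3 := by positivity
    have h4 : t * t ^ 3 ≤ t ^ 3 := mul_le_of_le_one_left h3.le h1
    have h5 : 2 * t ^ 3 ≤ t * (2 * t * (E - 1)) := by nlinarith [mul_pos h0 h0]
    refine le_trans ?_ h5
    rw [abs_le]
    constructor <;> nlinarith
  have hk2 : |t⁻¹ - (E - 1)⁻¹ - Real.exp (-t) / 2| ≤ 2 * t := by
    rw [abs_le] at hkey ⊢
    constructor <;> linarith [hkey.1, hkey.2]
  rw [expKernel, abs_mul, abs_of_pos (inv_pos.2 h0), inv_mul_le_iff₀ h0]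
  linarith

lemma abs_expKernel_le_of_one_le {t : ℝ} (h1 : 1 ≤ t) :
    |expKernel t| ≤ t ^ (-2 : ℝ) + Real.exp (-t) := by
  have h0 : 0 < t := by linarith
  have he : t ≤ Real.exp t - 1 := by linarith [Real.add_one_le_exp t]
  have hi : (Real.exp t - 1)⁻¹ ≤ t⁻¹ := inv_anti₀ h0 he
  have hi0 : 0 < (Real.exp t - 1)⁻¹ := inv_pos.2 (by linarith)
  have ht1 : t⁻¹ ≤ 1 := inv_le_one_of_one_le₀ h1
  have ht0 : 0 < t⁻¹ := inv_pos.2 h0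
  have hx := Real.exp_pos (-t)
  have hp : t ^ (-2 : ℝ) = t⁻¹ * t⁻¹ := by
    rw [Real.rpow_neg h0.le, ← mul_inv]
    norm_num [sq]
  rw [hp, expKernel, abs_le]
  constructor <;> nlinarith

lemma integrableOn_expKernel : IntegrableOn expKernel (Ioi 0) := by
  rw [← Ioc_union_Ioi_eq_Ioi (zero_le_one' ℝ)]
  refine IntegrableOn.union ?_ ?_
  · refine Measure.integrableOn_of_bounded (M := 2) (by simp)
      measurable_expKernel.aestronglyMeasurable ?_
    filter_upwards [ae_restrict_mem measurableSet_Ioc] with t ht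
    exact abs_expKernel_le_of_le_one ht.1 ht.2
  · have h : IntegrableOn (fun t : ℝ => Real.exp (-t)) (Ioi 1) := by
      simpa using exp_neg_integrableOn_Ioi 1 one_pos
    refine ((integrableOn_Ioi_rpow_of_lt (by norm_num : (-2 : ℝ) < -1) one_pos).add h).mono'
      measurable_expKernel.aestronglyMeasurable ?_
    filter_upwards [ae_restrict_mem measurableSet_Ioi] with t ht
    exact abs_expKernel_le_of_one_le (le_of_lt ht)

lemma integrableOn_expKernel_mul {f : ℝ → ℝ} (hf : Continuous f)
    (hb : ∀ t ∈ Ioi (0 : ℝ), |f t| ≤ 1) :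
    IntegrableOn (fun t => expKernel t * f t) (Ioi 0) := by
  refine Integrable.mono integrableOn_expKernel
    (measurable_expKernel.mul hf.measurable).aestronglyMeasurable ?_
  filter_upwards [ae_restrict_mem measurableSet_Ioi] with t ht
  rw [norm_mul]
  exact mul_le_of_le_one_right (norm_nonneg _) (hb t ht)

lemma abs_exp_neg_mul_one_sub_exp_neg_le_one {a t : ℝ} (ha : 0 ≤ a) (ht : 0 ≤ t) :
    |Real.exp (-(a * t)) * (1 - Real.exp (-t))| ≤ 1 := by
  have h1 : Real.exp (-t) ≤ 1 := Real.exp_le_one_iff.2 (by linarith)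
  have h2 : Real.exp (-(a * t)) ≤ 1 := Real.exp_le_one_iff.2 (by nlinarith)
  have h3 := Real.exp_pos (-t)
  have h4 := Real.exp_pos (-(a * t))
  rw [abs_of_nonneg (mul_nonneg h4.le (by linarith))]
  exact mul_le_one₀ h2 (by linarith) (by linarith)

lemma integrableOn_expKernel_mul_exp_mul (k : ℕ) :
    IntegrableOn (fun t => expKernel t * (Real.exp (-(k * t)) * (1 - Real.exp (-t)))) (Ioi 0) :=
  integrableOn_expKernel_mul (by fun_prop) fun _ ht =>
    abs_exp_neg_mul_one_sub_exp_neg_le_one k.cast_nonneg (le_of_lt ht)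

lemma expKernel_mul_exp_mul (k t : ℝ) (ht : 0 < t) :
    expKernel t * (Real.exp (-(k * t)) * (1 - Real.exp (-t))) =
      -((-k * Real.exp (-(k * t))) * (t⁻¹ * (1 - Real.exp (-t))) +
        Real.exp (-(k * t)) * (-(t ^ 2)⁻¹ * (1 - Real.exp (-t)) + t⁻¹ * Real.exp (-t))) -
      k * (t⁻¹ * (Real.exp (-(k * t)) - Real.exp (-((k + 1) * t)))) -
      1 / 2 * (t⁻¹ * (Real.exp (-((k + 1) * t)) - Real.exp (-((k + 1 + 1) * t)))) := by
  have h1 : Real.exp (-((k + 1) * t)) = Real.exp (-(k * t)) * Real.exp (-t) := by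
    rw [← Real.exp_add]; ring_nf
  have h2 : Real.exp (-((k + 1 + 1) * t)) = Real.exp (-(k * t)) * Real.exp (-t) ^ 2 := by
    rw [sq, ← Real.exp_add, ← Real.exp_add]; ring_nf
  have hlt : Real.exp (-t) < 1 := Real.exp_zero ▸ Real.exp_lt_exp.2 (by linarith)
  have h3 : (Real.exp t - 1)⁻¹ = Real.exp (-t) / (1 - Real.exp (-t)) := by
    have h5 : 1 < Real.exp t := Real.one_lt_exp_iff.2 ht
    have h4 : Real.exp t * Real.exp (-t) = 1 := by rw [← Real.exp_add]; simp
    rw [inv_eq_one_div, div_eq_div_iff (by linarith) (by linarith)]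
    linarith
  rw [expKernel, h1, h2, h3]
  have h6 : 1 - Real.exp (-t) ≠ 0 := by linarith
  field_simp
  ring

lemma tendsto_inv_mul_one_sub_exp_neg_zero :
    Tendsto (fun t : ℝ => t⁻¹ * (1 - Real.exp (-t))) (𝓝[>] 0) (𝓝 1) := by
  have h : HasDerivAt (fun t : ℝ => 1 - Real.exp (-t)) 1 0 := by
    simpa using ((hasDerivAt_neg (0 : ℝ)).exp).const_sub 1
  simpa using h.tendsto_slope_zero_right

lemma integral_expKernel_mul_exp_mul (k : ℕ) :
    ∫ t in Ioi (0 : ℝ), expKernel t * (Real.exp (-(k * t)) * (1 - Real.exp (-t))) =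
      1 - k * (Real.log (k + 1) - Real.log k) -
        1 / 2 * (Real.log (k + 1 + 1) - Real.log (k + 1)) := by
  have hK := integrableOn_expKernel_mul_exp_mul k
  have hA : IntegrableOn (fun t : ℝ =>
      (k : ℝ) * (t⁻¹ * (Real.exp (-(k * t)) - Real.exp (-((k + 1) * t))))) (Ioi 0) := by
    rcases Nat.eq_zero_or_pos k with rfl | hk
    · simp
    · exact (integrableOn_inv_mul_exp_sub_exp (Nat.cast_pos.2 hk)).const_mul _
  have hAi : ∫ t in Ioi (0 : ℝ),
      (k : ℝ) * (t⁻¹ * (Real.exp (-(k * t)) - Real.exp (-((k + 1) * t)))) =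
      k * (Real.log (k + 1) - Real.log k) := by
    rcases Nat.eq_zero_or_pos k with rfl | hk
    · simp
    · rw [integral_const_mul, integral_inv_mul_exp_sub_exp (Nat.cast_pos.2 hk)]
  have hB := (integrableOn_inv_mul_exp_sub_exp (a := (k : ℝ) + 1) (by positivity)).const_mul (1 / 2)
  have hBi := integral_inv_mul_exp_sub_exp (a := (k : ℝ) + 1) (by positivity)
  have hD : IntegrableOn (fun t : ℝ =>
      (-k * Real.exp (-(k * t))) * (t⁻¹ * (1 - Real.exp (-t))) +
        Real.exp (-(k * t)) * (-(t ^ 2)⁻¹ * (1 - Real.exp (-t)) + t⁻¹ * Real.exp (-t)))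
      (Ioi 0) := by
    refine ((hK.add (hA.add hB)).neg).congr_fun (fun t ht => ?_) measurableSet_Ioi
    simp only [Pi.neg_apply, Pi.add_apply]
    rw [expKernel_mul_exp_mul k t ht]
    ring
  have hDi := integral_Ioi_deriv_mul_eq_sub (a := (0 : ℝ)) (a' := (1 : ℝ)) (b' := 0)
    (u := fun t => Real.exp (-(k * t))) (u' := fun t => -k * Real.exp (-(k * t)))
    (v := fun t => t⁻¹ * (1 - Real.exp (-t)))
    (v' := fun t => -(t ^ 2)⁻¹ * (1 - Real.exp (-t)) + t⁻¹ * Real.exp (-t))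
    (fun t _ => by
      exact ((((hasDerivAt_id' t).const_mul (k : ℝ)).fun_neg).exp).congr_deriv (by ring))
    (fun t ht => by
      exact ((hasDerivAt_inv (ne_of_gt ht)).mul
        (((hasDerivAt_neg t).exp).const_sub 1)).congr_deriv (by ring))
    hD
    (by
      have h1 : Tendsto (fun t : ℝ => Real.exp (-(k * t))) (𝓝[>] 0) (𝓝 1) :=
        tendsto_nhdsWithin_of_tendsto_nhds <| by
          simpa using (by fun_prop : Continuous fun t : ℝ => Real.exp (-(k * t))).tendsto 0
      have h2 := h1.mul tendsto_inv_mul_one_sub_exp_neg_zero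
      rw [mul_one] at h2
      exact h2)
    (by
      refine squeeze_zero_norm' ?_ tendsto_inv_atTop_zero
      filter_upwards [eventually_gt_atTop 0] with t ht
      have h := abs_exp_neg_mul_one_sub_exp_neg_le_one (a := k) k.cast_nonneg ht.le
      rw [Pi.mul_apply, mul_left_comm, norm_mul, norm_inv, Real.norm_of_nonneg ht.le]
      exact mul_le_of_le_one_right (by positivity) h)
  rw [setIntegral_congr_fun measurableSet_Ioi fun t ht => expKernel_mul_exp_mul k t ht,
    integral_sub (by exact hD.neg.sub hA) hB, integral_sub (by exact hD.neg) hA, integral_neg,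
    hDi, hAi, integral_const_mul, hBi]
  ring

lemma integral_expKernel_mul_one_sub_exp (N : ℕ) :
    ∫ t in Ioi (0 : ℝ), expKernel t * (1 - Real.exp (-(N * t))) =
      Real.log N.factorial - N * Real.log N + N - 1 / 2 * Real.log (N + 1) := by
  induction N with
  | zero => simp
  | succ N ih =>
    have hN : IntegrableOn (fun t => expKernel t * (1 - Real.exp (-(N * t)))) (Ioi 0) := by
      refine integrableOn_expKernel_mul (by fun_prop) fun t ht => ?_
      have h1 : Real.exp (-(N * t)) ≤ 1 :=
        Real.exp_le_one_iff.2 (neg_nonpos.2 (mul_nonneg N.cast_nonneg (le_of_lt ht)))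
      rw [abs_le]
      constructor <;> linarith [Real.exp_pos (-(N * t))]
    have hsplit : ∀ t : ℝ, expKernel t * (1 - Real.exp (-((N + 1 : ℕ) * t))) =
        expKernel t * (1 - Real.exp (-(N * t))) +
          expKernel t * (Real.exp (-(N * t)) * (1 - Real.exp (-t))) := by
      intro t
      have : Real.exp (-((N + 1 : ℕ) * t)) = Real.exp (-(N * t)) * Real.exp (-t) := by
        rw [← Real.exp_add]; push_cast; ring_nf
      rw [this]
      ring
    simp_rw [hsplit]
    rw [integral_add hN (integrableOn_expKernel_mul_exp_mul N), ih,
      integral_expKernel_mul_exp_mul, Nat.factorial_succ, Nat.cast_mul,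
      Real.log_mul (by positivity) (by positivity)]
    push_cast
    ring

lemma tendsto_integral_expKernel_mul_one_sub_exp :
    Tendsto (fun N : ℕ => ∫ t in Ioi (0 : ℝ), expKernel t * (1 - Real.exp (-(N * t)))) atTop
      (𝓝 (∫ t in Ioi (0 : ℝ), expKernel t)) := by
  refine tendsto_integral_of_dominated_convergence (fun t => ‖expKernel t‖)
    (fun N => (measurable_expKernel.mul (by fun_prop)).aestronglyMeasurable)
    integrableOn_expKernel.norm (fun N => ?_) ?_
  · filter_upwards [ae_restrict_mem measurableSet_Ioi] with t ht
    have h1 : Real.exp (-(N * t)) ≤ 1 :=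
      Real.exp_le_one_iff.2 (neg_nonpos.2 (mul_nonneg N.cast_nonneg (le_of_lt ht)))
    rw [norm_mul, Real.norm_of_nonneg (sub_nonneg.2 h1)]
    exact mul_le_of_le_one_right (norm_nonneg _) (by linarith [Real.exp_pos (-(N * t))])
  · filter_upwards [ae_restrict_mem measurableSet_Ioi] with t ht
    have h : Tendsto (fun N : ℕ => Real.exp (-(N * t))) atTop (𝓝 0) :=
      Real.tendsto_exp_neg_atTop_nhds_zero.comp
        (tendsto_natCast_atTop_atTop.atTop_mul_const ht)
    simpa using (h.const_sub 1).const_mul (expKernel t)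

lemma integral_expKernel :
    ∫ t in Ioi (0 : ℝ), expKernel t = Real.log (2 * Real.pi) / 2 := by
  refine tendsto_nhds_unique tendsto_integral_expKernel_mul_one_sub_exp ?_
  have h1 : Tendsto (fun N : ℕ => Real.log (Stirling.stirlingSeq N)) atTop
      (𝓝 (Real.log (√Real.pi))) :=
    Stirling.tendsto_stirlingSeq_sqrt_pi.log (by positivity)
  have h2 : Tendsto (fun N : ℕ => Real.log ((N : ℝ) / (N + 1))) atTop (𝓝 0) := by
    simpa using (tendsto_natCast_div_add_atTop (1 : ℝ)).log one_ne_zero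
  have h3 := (h1.add (h2.const_mul (1 / 2))).add_const (1 / 2 * Real.log 2)
  have h4 : Real.log (√Real.pi) + 1 / 2 * 0 + 1 / 2 * Real.log 2 =
      Real.log (2 * Real.pi) / 2 := by
    rw [Real.log_sqrt Real.pi_pos.le, Real.log_mul two_ne_zero Real.pi_ne_zero]
    ring
  rw [h4] at h3
  refine h3.congr' ?_
  filter_upwards [eventually_gt_atTop 0] with N hN
  have hN' : (0 : ℝ) < N := Nat.cast_pos.2 hN
  rw [integral_expKernel_mul_one_sub_exp, Stirling.log_stirlingSeq_formula,
    Real.log_mul two_ne_zero hN'.ne', Real.log_div hN'.ne' (Real.exp_ne_zero 1), Real.log_exp,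
    Real.log_div hN'.ne' (by positivity)]
  ring

/-- `∫_ε^∞ (1/t)(1/t - 1/(e^t-1)) dt = -log(ε)/2 + C + o(1)` as `ε → 0⁺`,
where `C = (log(2π) - γ)/2`. -/
theorem integral_asymptotic_C :
    Tendsto
      (fun ε : ℝ =>
        (∫ t in Set.Ioi ε, (1 / t) * (1 / t - 1 / (Real.exp t - 1))) + Real.log ε / 2)
      (nhdsWithin 0 (Set.Ioi 0))
      (nhds ((Real.log (2 * Real.pi) - Real.eulerMascheroniConstant) / 2)) := by
  have h1 : Tendsto (fun ε : ℝ => ∫ t in Ioi ε, expKernel t) (𝓝[>] 0)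
      (𝓝 (Real.log (2 * Real.pi) / 2)) := by
    rw [← integral_expKernel]
    exact integrableOn_expKernel.continuousWithinAt_Ici_primitive_Ioi.mono_left
      (nhdsWithin_mono 0 Ioi_subset_Ici_self)
  have h2 := h1.add (tendsto_integral_inv_mul_exp_neg_add_log.const_mul (1 / 2))
  rw [show Real.log (2 * Real.pi) / 2 + 1 / 2 * -Real.eulerMascheroniConstant =
    (Real.log (2 * Real.pi) - Real.eulerMascheroniConstant) / 2 by ring] at h2
  refine h2.congr' ?_
  filter_upwards [self_mem_nhdsWithin] with ε hε
  have hε' : 0 < ε := hε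
  have hsplit : ∀ t : ℝ, 1 / t * (1 / t - 1 / (Real.exp t - 1)) =
      expKernel t + 1 / 2 * (t⁻¹ * Real.exp (-t)) := by
    intro t
    rw [expKernel]
    ring
  simp_rw [hsplit]
  rw [integral_add (integrableOn_expKernel.mono_set (Ioi_subset_Ioi hε'.le))
    ((integrableOn_inv_mul_exp_neg hε').const_mul _), integral_const_mul]
  ring
end

section
/- A(1) = 2C − 1/2, that is, ∫_0^∞ (1/x − 1/(e^x − 1))² dx = log(2π) − γ − 1/2. -/
open MeasureTheory

open Real Set Filter Topology

/-- The integrand of the Frullani integral `∫ (e^{-ax} - e^{-(a+1)x}) / x = log ((a + 1) / a)`. -/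
noncomputable def frullaniExp (a x : ℝ) : ℝ := x⁻¹ * (exp (-(a * x)) - exp (-((a + 1) * x)))

lemma one_sub_exp_neg_nonneg {x : ℝ} (hx : 0 ≤ x) : 0 ≤ 1 - exp (-x) := by
  have : exp (-x) ≤ 1 := exp_le_one_iff.2 (by linarith)
  linarith

lemma one_sub_exp_neg_le (x : ℝ) : 1 - exp (-x) ≤ x := by
  linarith [add_one_le_exp (-x)]

lemma exp_neg_add_one_mul (a x : ℝ) : exp (-((a + 1) * x)) = exp (-(a * x)) * exp (-x) := by
  rw [← exp_add]; ring_nf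

lemma exp_neg_add_two_mul (a x : ℝ) :
    exp (-((a + 2) * x)) = exp (-(a * x)) * exp (-x) ^ 2 := by
  rw [pow_two, ← exp_add, ← exp_add]; ring_nf

lemma integrableOn_exp_neg_mul {a : ℝ} (ha : 0 < a) :
    IntegrableOn (fun x => exp (-(a * x))) (Ioi 0) := by
  simpa using integrableOn_exp_mul_Ioi (neg_neg_of_pos ha) 0

lemma integrableOn_frullaniExp {a : ℝ} (ha : 0 < a) :
    IntegrableOn (frullaniExp a) (Ioi 0) := by
  refine Integrable.mono' (integrableOn_exp_neg_mul ha) ?_ ?_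
  · unfold frullaniExp
    exact Measurable.aestronglyMeasurable (by fun_prop)
  · refine (ae_restrict_mem measurableSet_Ioi).mono fun x hx => ?_
    have hx : 0 < x := hx
    have h0 := one_sub_exp_neg_nonneg hx.le
    have h : frullaniExp a x = exp (-(a * x)) * ((1 - exp (-x)) / x) := by
      rw [frullaniExp, exp_neg_add_one_mul]; ring
    rw [h, norm_of_nonneg (by positivity)]
    exact mul_le_of_le_one_right (exp_pos _).le ((div_le_one hx).2 (one_sub_exp_neg_le x))

lemma integral_frullaniExp {a : ℝ} (ha : 0 < a) :
    ∫ x in Ioi 0, frullaniExp a x = log ((a + 1) / a) := by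
  have h := Frullani.integral_Ioi_eq (f := fun x : ℝ => exp (-x)) (a := a) (b := a + 1)
    (L := 1) (R := 0) ?_ ha (by linarith) ?_ ?_ ?_
  · simpa [frullaniExp] using h
  · exact (Continuous.locallyIntegrable (by fun_prop)).locallyIntegrableOn _
  · have : Tendsto (fun x : ℝ => exp (-x)) (𝓝 0) (𝓝 (exp (-0))) :=
      Continuous.tendsto (by fun_prop) 0
    rw [neg_zero, exp_zero] at this
    exact this.mono_left nhdsWithin_le_nhds
  · exact tendsto_exp_neg_atTop_nhds_zero
  · exact integrableOn_frullaniExp ha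

lemma integrableOn_nat_mul_frullaniExp (n : ℕ) :
    IntegrableOn (fun x => n * frullaniExp n x) (Ioi 0) := by
  rcases n.eq_zero_or_pos with rfl | hn
  · simp
  · exact (integrableOn_frullaniExp (by exact_mod_cast hn)).const_mul _

lemma integral_nat_mul_frullaniExp (n : ℕ) :
    ∫ x in Ioi 0, n * frullaniExp n x = n * log ((n + 1) / n) := by
  rcases n.eq_zero_or_pos with rfl | hn
  · simp
  · rw [integral_const_mul, integral_frullaniExp (by exact_mod_cast hn)]

lemma integrableOn_exp_mul_sq (n : ℕ) :
    IntegrableOn (fun x : ℝ => exp (-(n * x)) * ((1 - exp (-x)) / x) ^ 2) (Ioi 0) := by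
  refine Integrable.mono' (integrable_inv_one_add_sq.const_mul 4).integrableOn ?_ ?_
  · exact Measurable.aestronglyMeasurable (by fun_prop)
  · refine (ae_restrict_mem measurableSet_Ioi).mono fun x hx => ?_
    have hx : 0 < x := hx
    rw [norm_of_nonneg (by positivity)]
    have h0 := one_sub_exp_neg_nonneg hx.le
    have h1 : exp (-(n * x)) ≤ 1 := exp_le_one_iff.2 (by simp; positivity)
    have h2 : (1 - exp (-x)) / x ≤ 2 / (1 + x) := by
      rw [div_le_div_iff₀ hx (by positivity)]
      nlinarith [one_sub_exp_neg_le x, exp_pos (-x)]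
    calc _ ≤ 1 * (2 / (1 + x)) ^ 2 := by gcongr
      _ ≤ 4 * (1 + x ^ 2)⁻¹ := by
        rw [one_mul, div_pow, ← div_eq_mul_inv]
        norm_num
        gcongr
        nlinarith

lemma integral_exp_mul_sq (n : ℕ) :
    ∫ x in Ioi (0 : ℝ), exp (-(n * x)) * ((1 - exp (-x)) / x) ^ 2
      = (n + 2) * log ((n + 2) / (n + 1)) - n * log ((n + 1) / n) := by
  have hpos : (0 : ℝ) < n + 1 := by positivity
  set E : ℝ → ℝ := fun x => exp (-(n * x)) * ((1 - exp (-x)) / x) ^ 2 with hE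
  set G : ℝ → ℝ := fun x => -(exp (-(n * x)) * (1 - exp (-x)) ^ 2 / x) with hG
  have hEi : IntegrableOn E (Ioi 0) := integrableOn_exp_mul_sq n
  have hD := (integrableOn_frullaniExp hpos).const_mul ((n : ℝ) + 2)
  have hDn := integrableOn_nat_mul_frullaniExp n
  have hbound : ∀ x : ℝ, 0 ≤ x → ‖G x‖ ≤ (1 - exp (-x)) ^ 2 / x := by
    intro x hx
    have h1 : exp (-(n * x)) ≤ 1 := exp_le_one_iff.2 (by simp; positivity)
    rw [hG, norm_neg, norm_of_nonneg (by positivity)]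
    gcongr
    exact mul_le_of_le_one_left (by positivity) h1
  have hG0 : G 0 = 0 := by simp [hG]
  have hcont : ContinuousWithinAt G (Ici 0) 0 := by
    rw [ContinuousWithinAt, hG0]
    refine squeeze_zero_norm' (a := fun x => x) ?_
      (tendsto_id.mono_left nhdsWithin_le_nhds)
    filter_upwards [self_mem_nhdsWithin] with x hx
    have hx : 0 ≤ x := hx
    refine (hbound x hx).trans (div_le_of_le_mul₀ hx hx ?_)
    have := one_sub_exp_neg_nonneg hx
    nlinarith [one_sub_exp_neg_le x]
  have htop : Tendsto G atTop (𝓝 0) := by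
    refine squeeze_zero_norm' (a := fun x => x⁻¹) ?_ tendsto_inv_atTop_zero
    filter_upwards [eventually_gt_atTop 0] with x hx
    refine (hbound x hx.le).trans ?_
    rw [div_eq_mul_inv]
    refine mul_le_of_le_one_left (by positivity) ?_
    have := one_sub_exp_neg_nonneg hx.le
    nlinarith [exp_pos (-x)]
  have hderiv : ∀ x ∈ Ioi (0 : ℝ), HasDerivAt G
      (E x - (n + 2) * frullaniExp (n + 1) x + n * frullaniExp n x) x := by
    intro x hx
    have hx : x ≠ 0 := ne_of_gt hx
    have h1 : HasDerivAt (fun x : ℝ => exp (-(n * x))) (exp (-(n * x)) * -n) x := by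
      simpa using ((hasDerivAt_id x).const_mul (n : ℝ)).neg.exp
    have h2 : HasDerivAt (fun x : ℝ => exp (-x)) (exp (-x) * -1) x := by
      simpa using (hasDerivAt_id x).neg.exp
    refine (((h1.mul ((h2.const_sub 1).pow 2)).div (hasDerivAt_id x) hx).neg).congr_deriv ?_
    have e2 : exp (-(((n : ℝ) + 1 + 1) * x)) = exp (-(n * x)) * exp (-x) ^ 2 := by
      rw [← exp_neg_add_two_mul]; ring_nf
    simp only [hE, frullaniExp, e2, exp_neg_add_one_mul, Pi.mul_apply, Pi.pow_apply, id]
    field_simp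
    ring
  have key := integral_Ioi_of_hasDerivAt_of_tendsto hcont hderiv ((hEi.sub hD).add hDn) htop
  rw [hG0, integral_add (by exact hEi.sub hD) hDn, integral_sub hEi hD, integral_const_mul,
    integral_frullaniExp hpos, integral_nat_mul_frullaniExp] at key
  have : (n : ℝ) + 1 + 1 = n + 2 := by ring
  rw [this] at key
  linarith

lemma exp_mul_sub_sq (n : ℕ) (x : ℝ) :
    exp (-(n * x)) * ((1 - exp (-x)) / x - exp (-x)) ^ 2
      = exp (-(n * x)) * ((1 - exp (-x)) / x) ^ 2 - 2 * frullaniExp (n + 1) x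
        + exp (-((n + 2) * x)) := by
  have e2 : exp (-(((n : ℝ) + 1 + 1) * x)) = exp (-(n * x)) * exp (-x) ^ 2 := by
    rw [← exp_neg_add_two_mul]; ring_nf
  rw [frullaniExp, e2, exp_neg_add_one_mul, exp_neg_add_two_mul]
  ring

lemma integrableOn_exp_mul_sub_sq (n : ℕ) :
    IntegrableOn (fun x : ℝ => exp (-(n * x)) * ((1 - exp (-x)) / x - exp (-x)) ^ 2) (Ioi 0) := by
  simp_rw [exp_mul_sub_sq]
  exact ((integrableOn_exp_mul_sq n).sub
    ((integrableOn_frullaniExp (by positivity)).const_mul 2)).add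
    (integrableOn_exp_neg_mul (by positivity))

lemma integral_exp_mul_sub_sq (n : ℕ) :
    ∫ x in Ioi (0 : ℝ), exp (-(n * x)) * ((1 - exp (-x)) / x - exp (-x)) ^ 2
      = n * log ((n + 2) / (n + 1)) - n * log ((n + 1) / n) + 1 / (n + 2) := by
  have hD := (integrableOn_frullaniExp (a := (n : ℝ) + 1) (by positivity)).const_mul 2
  have hexp : ∫ x in Ioi (0 : ℝ), exp (-(((n : ℝ) + 2) * x)) = 1 / (n + 2) := by
    have h := integral_exp_mul_Ioi (a := -((n : ℝ) + 2)) (by linarith [n.cast_nonneg (α := ℝ)]) 0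
    simp only [neg_mul, mul_zero, exp_zero] at h
    rw [h, neg_div_neg_eq]
  simp_rw [exp_mul_sub_sq]
  rw [integral_add (by exact (integrableOn_exp_mul_sq n).sub hD)
      (integrableOn_exp_neg_mul (by positivity)),
    integral_sub (integrableOn_exp_mul_sq n) hD, integral_const_mul,
    integral_frullaniExp (by positivity), integral_exp_mul_sq, hexp]
  have : (n : ℝ) + 1 + 1 = n + 2 := by ring
  rw [this]
  ring

lemma hasSum_sq_inv_sub_inv_exp {x : ℝ} (hx : 0 < x) :
    HasSum (fun n : ℕ => (n + 1) * (exp (-(n * x)) * ((1 - exp (-x)) / x - exp (-x)) ^ 2))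
      ((1 / x - 1 / (exp x - 1)) ^ 2) := by
  have hlt : exp (-x) < 1 := exp_lt_one_iff.2 (by linarith)
  have h := (hasSum_choose_mul_geometric_of_norm_lt_one 1 (r := exp (-x))
    (by rwa [norm_of_nonneg (exp_pos _).le])).mul_right (((1 - exp (-x)) / x - exp (-x)) ^ 2)
  have hne' : exp x - 1 ≠ 0 := by linarith [add_one_lt_exp hx.ne']
  have hval : (1 / x - 1 / (exp x - 1)) ^ 2
      = 1 / (1 - exp (-x)) ^ (1 + 1) * ((1 - exp (-x)) / x - exp (-x)) ^ 2 := by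
    have he : 1 - exp (-x) = (exp x - 1) / exp x := by
      rw [exp_neg]; field_simp
    rw [he, exp_neg, div_pow]
    field_simp
    ring
  rw [hval]
  refine h.congr_fun fun n => ?_
  rw [← exp_nat_mul, Nat.choose_one_right, mul_neg]
  push_cast
  ring

/-- The partial sums of the series obtained by termwise integration. -/
lemma sum_range_eq (N : ℕ) :
    ∑ n ∈ Finset.range N, ((n : ℝ) + 1) *
        (n * log ((n + 2) / (n + 1)) - n * log ((n + 1) / n) + 1 / (n + 2))
      = 2 * log N.factorial + N * (N - 1) * log (N + 1) - N * (N + 1) * log N + N + 1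
        - harmonic (N + 1) := by
  induction N with
  | zero => simp
  | succ N ih =>
    rw [Finset.sum_range_succ, ih, harmonic_succ (N + 1), Nat.factorial_succ]
    have h1 : (N : ℝ) + 1 ≠ 0 := by positivity
    have h2 : (N : ℝ) + 2 ≠ 0 := by positivity
    have h3 : (N.factorial : ℝ) ≠ 0 := by positivity
    push_cast
    have h4 : (N : ℝ) * log ((N + 1) / N) = N * (log (N + 1) - log N) := by
      rcases N.eq_zero_or_pos with rfl | hN
      · simp
      · rw [log_div h1 (by positivity)]
    rw [h4, log_div h2 h1, log_mul h1 h3, show (N : ℝ) + 1 + 1 = N + 2 by ring]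
    field_simp
    ring

lemma tendsto_mul_log_one_add_inv :
    Tendsto (fun N : ℕ => ((N : ℝ) ^ 2 - N) * (log (N + 1) - log N) - N) atTop (𝓝 (-(3 / 2))) := by
  rw [tendsto_iff_norm_sub_tendsto_zero]
  have hlim : Tendsto (fun N : ℕ => 3 / 2 * ((N : ℝ))⁻¹) atTop (𝓝 0) := by
    simpa using (tendsto_inv_atTop_nhds_zero_nat (𝕜 := ℝ)).const_mul (3 / 2)
  refine squeeze_zero' (Eventually.of_forall fun _ => norm_nonneg _) ?_ hlim
  filter_upwards [eventually_gt_atTop 1] with N hN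
  have hN : (1 : ℝ) < N := by exact_mod_cast hN
  have hN0 : (0 : ℝ) < N := by linarith
  have habs : |-(N : ℝ)⁻¹| = (N : ℝ)⁻¹ := by rw [abs_neg, abs_of_pos (by positivity)]
  have h := abs_log_sub_add_sum_range_le (x := -(N : ℝ)⁻¹)
    (by rw [habs]; exact inv_lt_one_of_one_lt₀ hN) 2
  rw [habs, show 1 - -(N : ℝ)⁻¹ = (N + 1) / N by field_simp; ring,
    log_div (by positivity) hN0.ne'] at h
  simp only [Finset.sum_range_succ, Finset.sum_range_zero] at h
  set l := log ((N : ℝ) + 1) - log N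
  have hpos : (0 : ℝ) < N ^ 2 - N := by nlinarith
  have h' := mul_le_mul_of_nonneg_left h hpos.le
  rw [← abs_of_pos hpos, ← abs_mul, abs_of_pos hpos] at h'
  have hr : ((N : ℝ) ^ 2 - N) * ((N : ℝ)⁻¹ ^ (2 + 1) / (1 - (N : ℝ)⁻¹)) = (N : ℝ)⁻¹ := by
    have : (N : ℝ) - 1 ≠ 0 := by linarith
    field_simp
    simp [hN0.ne']
  rw [hr] at h'
  have hsplit : ((N : ℝ) ^ 2 - N) * l - N - -(3 / 2)
      = ((N : ℝ) ^ 2 - N) * (0 + (-(N : ℝ)⁻¹) ^ (0 + 1) / ((0 : ℕ) + 1)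
        + (-(N : ℝ)⁻¹) ^ (1 + 1) / ((1 : ℕ) + 1) + l) + 1 / 2 * (N : ℝ)⁻¹ := by
    push_cast
    field_simp
    ring
  rw [hsplit, norm_eq_abs]
  refine (abs_add_le _ _).trans ?_
  rw [abs_of_pos (a := 1 / 2 * (N : ℝ)⁻¹) (by positivity)]
  linarith

lemma tendsto_sum_range :
    Tendsto (fun N : ℕ => ∑ n ∈ Finset.range N, ((n : ℝ) + 1) *
        (n * log ((n + 2) / (n + 1)) - n * log ((n + 1) / n) + 1 / (n + 2))) atTop
      (𝓝 (log (2 * π) - eulerMascheroniConstant - 1 / 2)) := by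
  have hS : Tendsto (fun N => log (Stirling.stirlingSeq N)) atTop (𝓝 (log √π)) :=
    Stirling.tendsto_stirlingSeq_sqrt_pi.log (by positivity)
  have hH := tendsto_harmonic_sub_log.comp (tendsto_add_atTop_nat 1)
  have hL : Tendsto (fun N : ℕ => log ((N : ℝ) + 1) - log N) atTop (𝓝 0) := by
    simpa using tendsto_log_nat_add_one_sub_log
  have h := ((((hS.const_mul 2).add_const (log 2)).sub hL).add
    tendsto_mul_log_one_add_inv).sub hH |>.add_const 1
  have hval : 2 * log √π + log 2 - 0 + -(3 / 2) - eulerMascheroniConstant + 1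
      = log (2 * π) - eulerMascheroniConstant - 1 / 2 := by
    rw [log_sqrt pi_pos.le, log_mul two_ne_zero pi_ne_zero]
    ring
  rw [hval] at h
  refine h.congr' ?_
  filter_upwards [eventually_gt_atTop 0] with N hN
  have hN : (N : ℝ) ≠ 0 := by positivity
  rw [sum_range_eq, Stirling.log_stirlingSeq_formula, log_div hN (exp_ne_zero _), log_exp,
    log_mul two_ne_zero hN]
  simp only [Function.comp_apply]
  push_cast
  ring

/-- `A(1) = ∫_0^∞ (1/x - 1/(e^x-1))² dx = log(2π) - γ - 1/2`. -/
theorem A_one :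
    ∫ x in Set.Ioi (0 : ℝ), (1 / x - 1 / (Real.exp x - 1)) ^ 2
      = Real.log (2 * Real.pi) - Real.eulerMascheroniConstant - 1 / 2 := by
  set F : ℕ → ℝ → ℝ := fun n x =>
    (n + 1) * (exp (-(n * x)) * ((1 - exp (-x)) / x - exp (-x)) ^ 2) with hF
  have hFnn : ∀ n x, 0 ≤ F n x := fun n x => by positivity
  have hFint : ∀ n, ∫ x in Ioi 0, F n x = ((n : ℝ) + 1) *
      (n * log ((n + 2) / (n + 1)) - n * log ((n + 1) / n) + 1 / (n + 2)) := fun n => by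
    rw [hF, integral_const_mul, integral_exp_mul_sub_sq]
  have hsum : HasSum (fun n => ∫ x in Ioi 0, F n x)
      (log (2 * π) - eulerMascheroniConstant - 1 / 2) := by
    rw [hasSum_iff_tendsto_nat_of_nonneg fun n => integral_nonneg (hFnn n)]
    simp_rw [hFint]
    exact tendsto_sum_range
  have hswap := hasSum_integral_of_summable_integral_norm
    (fun n => (integrableOn_exp_mul_sub_sq n).const_mul ((n : ℝ) + 1))
    (hsum.summable.congr fun n =>
      integral_congr_ae (.of_forall fun x => (norm_of_nonneg (hFnn n x)).symm))
  rw [← hswap.unique hsum]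
  exact setIntegral_congr_fun measurableSet_Ioi fun x hx =>
    (hasSum_sq_inv_sub_inv_exp hx).tsum_eq.symm
end
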